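/- For every integer K ≥ 1, every halting set H ⊆ Σ with Σ = {1,…,K}, and every function M : Σ × Σ → Σ, there exists a one-layer, two-head decoder-only Transformer with context window 2 (as specified in the context) such that, taking the next-token function f to be greedy decoding of this Transformer, for every input x ∈ Σ* with |x| ≥ 2 the appending-style system with window length N = 2 produces exactly the same sequence of maintained strings r⁽ᵗ⁾, and halts at exactly the same step (if at all), as the (2,1)-restricted system with rule M and halting set H on input x. -/

import Mathlib

/-!
A one-layer, two-head decoder-only Transformer with context window 2.

The token alphabet is `Fin K` (identified with `{1, …, K}`), and the model
dimension is `d = 3K + K²`; we index the `d` coordinates by the block type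
`TIdx K = Fin K ⊕ (Fin K ⊕ (Fin K ⊕ Fin K × Fin K))`, i.e. a token block of
size `K`, a feature block of size `2K` (split into its two `K`-sized halves),
and a pair block of size `K²`.
-/

open Matrix

/-- Index type for the `d = 3K + K²` coordinates, in blocks of sizes
`K`, `K`, `K`, `K²`. -/
abbrev TIdx (K : ℕ) : Type := Fin K ⊕ (Fin K ⊕ (Fin K ⊕ Fin K × Fin K))

/-- The embedding of token `a`: the row vector `(e_a; 0_{2K}; 0_{K²})`. -/
def emb (K : ℕ) (a : Fin K) : TIdx K → ℝ
  | Sum.inl j => if j = a then 1 else 0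
  | Sum.inr _ => 0

/-- The output (at position 2) of one softmax attention head with parameter
matrices `WQ, WK, WV ∈ ℝ^{d × K}` on the input pair `(a, b)`:
queries/keys/values are obtained from the embeddings `x₁ = emb a`,
`x₂ = emb b`, attention scores are scaled by `1/√K`, and the output is the
softmax-weighted combination of the two values. -/
noncomputable def headOut (K : ℕ) (WQ WKm WV : Matrix (TIdx K) (Fin K) ℝ)
    (a b : Fin K) : Fin K → ℝ :=
  let q := Matrix.vecMul (emb K b) WQ
  let k₁ := Matrix.vecMul (emb K a) WKm
  let k₂ := Matrix.vecMul (emb K b) WKm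
  let v₁ := Matrix.vecMul (emb K a) WV
  let v₂ := Matrix.vecMul (emb K b) WV
  let s₁ := Real.exp (q ⬝ᵥ k₁ / Real.sqrt K)
  let s₂ := Real.exp (q ⬝ᵥ k₂ / Real.sqrt K)
  (s₁ / (s₁ + s₂)) • v₁ + (s₂ / (s₁ + s₂)) • v₂

/-- The logit row `y₂` at position 2 of the one-layer, two-head decoder-only
Transformer on input `(a, b)`: two attention heads (`prev` and `self`) whose
concatenated outputs are projected by `W_O ∈ ℝ^{2K × d}` and added residually
to `x₂`, followed by a ReLU feed-forward layer `(W₁, b₁, W₂)` with a residual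
connection, and a classification head `W ∈ ℝ^{d × K}`. -/
noncomputable def logits (K m : ℕ)
    (WQp WKp WVp WQs WKs WVs : Matrix (TIdx K) (Fin K) ℝ)
    (WO : Matrix (Fin K ⊕ Fin K) (TIdx K) ℝ)
    (W₁ : Matrix (TIdx K) (Fin m) ℝ) (b₁ : Fin m → ℝ)
    (W₂ : Matrix (Fin m) (TIdx K) ℝ)
    (W : Matrix (TIdx K) (Fin K) ℝ)
    (a b : Fin K) : Fin K → ℝ :=
  let oprev := headOut K WQp WKp WVp a b
  let oself := headOut K WQs WKs WVs a b
  let z := emb K b + Matrix.vecMul (Sum.elim oprev oself) WO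
  let x' := z + Matrix.vecMul (fun j => max (Matrix.vecMul z W₁ j + b₁ j) 0) W₂
  Matrix.vecMul x' W

/-- One step of the appending-style system with window length `N`, halting set
`H` and next-token function `f`: decode `x̂ = f w`, where `w` is the prefix of
`r` of length `min |r| N`; halt (`none`) if `x̂ ∈ H`, otherwise delete the
first token and append `x̂` at the end. -/
def appStep (K N : ℕ) (H : Finset (Fin K)) (f : List (Fin K) → Fin K)
    (r : List (Fin K)) : Option (List (Fin K)) :=
  if f (r.take (min r.length N)) ∈ H then none
  else some (r.drop 1 ++ [f (r.take (min r.length N))])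

/-- `appTraj K N H f x t` is the maintained string `r⁽ᵗ⁺¹⁾` of the
appending-style system (index `0` corresponds to `r⁽¹⁾ = x`), or `none` if the
system has halted by then. -/
def appTraj (K N : ℕ) (H : Finset (Fin K)) (f : List (Fin K) → Fin K)
    (x : List (Fin K)) : ℕ → Option (List (Fin K))
  | 0 => some x
  | t + 1 => (appTraj K N H f x t).bind (appStep K N H f)

/-- One step of the `(2,1)`-restricted system with rule `M` and halting set
`H`: read the first two tokens `(a, b)` and compute `M a b`; halt (`none`) if
`M a b ∈ H`, otherwise delete the first token and append `M a b` at the end. -/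
def restStep (K : ℕ) (H : Finset (Fin K)) (M : Fin K → Fin K → Fin K)
    (r : List (Fin K)) : Option (List (Fin K)) :=
  match r with
  | a :: b :: _ => if M a b ∈ H then none else some (r.drop 1 ++ [M a b])
  | _ => none

/-- `restTraj K H M x t` is the maintained string `r⁽ᵗ⁺¹⁾` of the
`(2,1)`-restricted system (index `0` corresponds to `r⁽¹⁾ = x`), or `none` if
the system has halted by then. -/
def restTraj (K : ℕ) (H : Finset (Fin K)) (M : Fin K → Fin K → Fin K)
    (x : List (Fin K)) : ℕ → Option (List (Fin K))
  | 0 => some x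
  | t + 1 => (restTraj K H M x t).bind (restStep K H M)

theorem emb_vecMul {ι : Type*} (K : ℕ) (a : Fin K) (A : Matrix (TIdx K) ι ℝ) :
    Matrix.vecMul (emb K a) A = A (Sum.inl a) := by
  ext j
  simp [Matrix.vecMul, dotProduct, emb]

/-- With vanishing queries the attention is uniform, so a head outputs the average of the
two values. -/
theorem headOut_zero_query (K : ℕ) (WKm WV : Matrix (TIdx K) (Fin K) ℝ) (a b : Fin K) :
    headOut K 0 WKm WV a b = (1 / 2 : ℝ) • (WV (Sum.inl a) + WV (Sum.inl b)) := by
  simp only [headOut, emb_vecMul, Matrix.vecMul_zero, zero_dotProduct, zero_div, Real.exp_zero,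
    smul_add]
  norm_num

/-- Value matrix sending the embedding of `a` to `2 e_a`. -/
def valueMatrix (K : ℕ) : Matrix (TIdx K) (Fin K) ℝ
  | Sum.inl i, j => if i = j then 2 else 0
  | Sum.inr _, _ => 0

/-- Output projection writing the first head into the first feature half and discarding the
second head. -/
def outputMatrix (K : ℕ) : Matrix (Fin K ⊕ Fin K) (TIdx K) ℝ
  | Sum.inl i, Sum.inr (Sum.inl j) => if i = j then 1 else 0
  | _, _ => 0

/-- Feed-forward input weights: the neuron of the pair `(i, j)` reads
`feature i - token i + token j`. -/
def pairDetector (K : ℕ) : Matrix (TIdx K) (Fin (K * K)) ℝ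
  | Sum.inl l, n =>
    (if l = (finProdFinEquiv.symm n).2 then 1 else 0) -
      (if l = (finProdFinEquiv.symm n).1 then 1 else 0)
  | Sum.inr (Sum.inl l), n => if l = (finProdFinEquiv.symm n).1 then 1 else 0
  | _, _ => 0

/-- Feed-forward output weights: each neuron writes to the coordinate of its pair. -/
def pairWriter (K : ℕ) : Matrix (Fin (K * K)) (TIdx K) ℝ
  | n, Sum.inr (Sum.inr (Sum.inr p)) => if n = finProdFinEquiv p then 1 else 0
  | _, _ => 0

/-- Classification head mapping the coordinate of the pair `(i, j)` to `e_{M i j}`. -/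
def ruleHead (K : ℕ) (M : Fin K → Fin K → Fin K) : Matrix (TIdx K) (Fin K) ℝ
  | Sum.inr (Sum.inr (Sum.inr p)), k => if k = M p.1 p.2 then 1 else 0
  | _, _ => 0

theorem elim_vecMul_outputMatrix (K : ℕ) (u v : Fin K → ℝ) :
    Matrix.vecMul (Sum.elim u v) (outputMatrix K) = Sum.elim (fun _ => 0) (Sum.elim u (fun _ => 0)) := by
  ext (j | j | j | j) <;> simp [Matrix.vecMul, dotProduct, outputMatrix]

theorem pairWriter_row (K : ℕ) (p : Fin K × Fin K) :
    pairWriter K (finProdFinEquiv p) = Pi.single (Sum.inr (Sum.inr (Sum.inr p))) 1 := by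
  ext (j | j | j | j) <;> simp [pairWriter, Pi.single_apply, eq_comm]

theorem relu_pair_indicator {α : Type*} [DecidableEq α] (a b : α) (p : α × α) :
    max ((if a = p.1 then (1 : ℝ) else 0) + (if b = p.2 then 1 else 0) + -1) 0 =
      if p = (a, b) then 1 else 0 := by
  obtain ⟨i, j⟩ := p
  by_cases ha : a = i <;> by_cases hb : b = j <;>
    simp [ha, hb, Prod.ext_iff, eq_comm]

theorem logits_pair_lookup (K : ℕ) (M : Fin K → Fin K → Fin K) (a b k : Fin K) :
    logits K (K * K) 0 0 (valueMatrix K) 0 0 0 (outputMatrix K) (pairDetector K) (fun _ => -1)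
      (pairWriter K) (ruleHead K M) a b k = if k = M a b then 1 else 0 := by
  have hidden : (fun n => max (Matrix.vecMul
      (emb K b + Matrix.vecMul (Sum.elim (headOut K 0 0 (valueMatrix K) a b)
        (headOut K 0 0 0 a b)) (outputMatrix K)) (pairDetector K) n + -1) 0) =
      Pi.single (finProdFinEquiv (a, b)) (1 : ℝ) := by
    ext n
    obtain ⟨p, rfl⟩ := finProdFinEquiv.surjective n
    have hpre : Matrix.vecMul
        (emb K b + Matrix.vecMul (Sum.elim (headOut K 0 0 (valueMatrix K) a b)
          (headOut K 0 0 0 a b)) (outputMatrix K)) (pairDetector K) (finProdFinEquiv p) =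
        (if a = p.1 then (1 : ℝ) else 0) + (if b = p.2 then 1 else 0) := by
      rw [Matrix.add_vecMul, emb_vecMul, elim_vecMul_outputMatrix]
      simp only [headOut_zero_query]
      simp [Matrix.vecMul, dotProduct, pairDetector, valueMatrix, -finProdFinEquiv_symm_apply]
      split_ifs <;> norm_num
    rw [hpre, relu_pair_indicator]
    simp [Pi.single_apply]
  simp only [logits]
  rw [hidden, Matrix.single_one_vecMul, Matrix.row, pairWriter_row, Matrix.add_vecMul,
    Matrix.add_vecMul, emb_vecMul, elim_vecMul_outputMatrix, Matrix.single_one_vecMul]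
  simp [Matrix.vecMul, dotProduct, ruleHead]

theorem length_of_restTraj {K : ℕ} {H : Finset (Fin K)} {M : Fin K → Fin K → Fin K}
    {x : List (Fin K)} (t : ℕ) {r : List (Fin K)} (h : restTraj K H M x t = some r) :
    r.length = x.length := by
  induction t generalizing r with
  | zero => simp_all [restTraj]
  | succ t ih =>
    obtain ⟨s, hs, hr⟩ := Option.bind_eq_some_iff.mp h
    rw [← ih hs]
    match s, hr with
    | a :: b :: l, hr =>
      simp only [restStep] at hr
      split_ifs at hr
      simp at hr
      simp [← hr]

theorem appStep_two_eq_restStep {K : ℕ} {H : Finset (Fin K)} {M : Fin K → Fin K → Fin K}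
    {f : List (Fin K) → Fin K} (hf : ∀ a b, f [a, b] = M a b) {r : List (Fin K)}
    (hr : 2 ≤ r.length) : appStep K 2 H f r = restStep K H M r := by
  match r, hr with
  | a :: b :: l, _ => simp [appStep, restStep, hf]

theorem appTraj_two_eq_restTraj {K : ℕ} {H : Finset (Fin K)} {M : Fin K → Fin K → Fin K}
    {f : List (Fin K) → Fin K} (hf : ∀ a b, f [a, b] = M a b) {x : List (Fin K)}
    (hx : 2 ≤ x.length) (t : ℕ) : appTraj K 2 H f x t = restTraj K H M x t := by
  induction t with
  | zero => rfl
  | succ t ih =>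
    rw [appTraj, restTraj, ih]
    exact Option.bind_congr fun r hr =>
      appStep_two_eq_restStep hf (by rwa [length_of_restTraj t hr])

/-- For every `K ≥ 1`, every halting set `H ⊆ Σ` with
`Σ = {1, …, K}`, and every rule `M : Σ × Σ → Σ`, there exists a one-layer,
two-head decoder-only Transformer with context window 2 such that on every
length-2 context `(a, b)` its logit row has the unique maximizer `M a b`
(so greedy decoding outputs `M a b`), and, taking the next-token function `f`
to be greedy decoding of this Transformer, for every input `x` with `|x| ≥ 2`
the appending-style system with window length `N = 2` produces exactly the
same sequence of maintained strings, and halts at exactly the same step (if at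
all), as the `(2,1)`-restricted system with rule `M` and halting set `H`. -/
theorem transformer_appending_simulates_restricted_system
    (K : ℕ) (hK : 1 ≤ K) (H : Finset (Fin K)) (M : Fin K → Fin K → Fin K) :
    ∃ (m : ℕ) (WQp WKp WVp WQs WKs WVs : Matrix (TIdx K) (Fin K) ℝ)
      (WO : Matrix (Fin K ⊕ Fin K) (TIdx K) ℝ)
      (W₁ : Matrix (TIdx K) (Fin m) ℝ) (b₁ : Fin m → ℝ)
      (W₂ : Matrix (Fin m) (TIdx K) ℝ)
      (W : Matrix (TIdx K) (Fin K) ℝ),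
      (∀ a b k : Fin K, k ≠ M a b →
        logits K m WQp WKp WVp WQs WKs WVs WO W₁ b₁ W₂ W a b k
          < logits K m WQp WKp WVp WQs WKs WVs WO W₁ b₁ W₂ W a b (M a b)) ∧
      ∀ f : List (Fin K) → Fin K,
        (∀ a b k : Fin K, k ≠ f [a, b] →
          logits K m WQp WKp WVp WQs WKs WVs WO W₁ b₁ W₂ W a b k
            < logits K m WQp WKp WVp WQs WKs WVs WO W₁ b₁ W₂ W a b
                (f [a, b])) →
        ∀ x : List (Fin K), 2 ≤ x.length →
          ∀ t, appTraj K 2 H f x t = restTraj K H M x t := by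
  refine ⟨K * K, 0, 0, valueMatrix K, 0, 0, 0, outputMatrix K, pairDetector K, fun _ => -1,
    pairWriter K, ruleHead K M, ?_, ?_⟩
  · intro a b k hk
    simp [logits_pair_lookup, hk]
  · intro f hf x hx t
    refine appTraj_two_eq_restTraj (fun a b => ?_) hx t
    by_contra hne
    have h := hf a b (M a b) (Ne.symm hne)
    simp only [logits_pair_lookup, if_neg hne, if_true] at h
    norm_num at h
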